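/- Let n ≥ 1 and k be natural numbers, and let J be a real skew-symmetric 2n×2n matrix whose kernel has dimension 2k. Then there exists a real (2(n+k))×(2n) matrix Y of rank 2n such that Yᵀ Ω_{n+k} Y = J, where Ω_{n+k} is the standard symplectic form on ℝ^{2(n+k)}. -/

import Mathlib

open scoped Matrix

/-- The standard symplectic form on `ℝ^(2m)`: the block-diagonal matrix with `m` copies of
`[[0, 1], [-1, 0]]` along the diagonal. -/
def stdSymplectic (m : ℕ) : Matrix (Fin (2 * m)) (Fin (2 * m)) ℝ :=
  Matrix.of fun i j =>
    if i.val % 2 = 0 ∧ j.val = i.val + 1 then 1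
    else if j.val % 2 = 0 ∧ i.val = j.val + 1 then -1
    else 0

lemma aux_sum_two (φ : ℕ → ℝ) (N : ℕ) :
    ∑ i : Fin (2 * N), φ i.val = ∑ p ∈ Finset.range N, (φ (2 * p) + φ (2 * p + 1)) := by
  rw [Fin.sum_univ_eq_sum_range (fun i => φ i)]
  induction N with
  | zero => simp
  | succ N ih =>
    rw [Finset.sum_range_succ, ← ih, show 2 * (N + 1) = 2 * N + 1 + 1 by ring,
      Finset.sum_range_succ, Finset.sum_range_succ]
    ring

/-- Interleave two families of rows. -/
def auxRow {d : ℕ} (F G : ℕ → Fin d → ℝ) (i : ℕ) : Fin d → ℝ :=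
  if i % 2 = 0 then F (i / 2) else G (i / 2)

lemma aux_form {d N : ℕ} (F G : ℕ → Fin d → ℝ) (x y : Fin d) :
    ((Matrix.of fun (i : Fin (2 * N)) j => auxRow F G i.val j)ᵀ * stdSymplectic N *
      (Matrix.of fun (i : Fin (2 * N)) j => auxRow F G i.val j)) x y
      = ∑ p ∈ Finset.range N, (F p x * G p y - G p x * F p y) := by
  have hE : ∀ p, auxRow F G (2 * p) = F p := by
    intro p; simp [auxRow]
  have hO : ∀ p, auxRow F G (2 * p + 1) = G p := by
    intro p
    have h1 : (2 * p + 1) % 2 = 1 := by omega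
    have h2 : (2 * p + 1) / 2 = p := by omega
    simp [auxRow, h1, h2]
  rw [Matrix.mul_assoc, Matrix.mul_apply]
  let ψ : ℕ → ℕ → ℝ := fun i j =>
    if i % 2 = 0 ∧ j = i + 1 then 1
    else if j % 2 = 0 ∧ i = j + 1 then -1
    else 0
  have key : ∀ i : Fin (2 * N), (Matrix.of fun (i : Fin (2 * N)) j => auxRow F G i.val j)ᵀ x i *
      (stdSymplectic N * (Matrix.of fun (i : Fin (2 * N)) j => auxRow F G i.val j)) i y
      = (fun a : ℕ => auxRow F G a x *
        ∑ q ∈ Finset.range N, (ψ a (2 * q) * F q y + ψ a (2 * q + 1) * G q y)) i.val := by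
    intro i
    rw [Matrix.mul_apply]
    simp only [Matrix.transpose_apply, Matrix.of_apply]
    congr 1
    have := aux_sum_two (fun j => ψ i.val j * auxRow F G j y) N
    simp only [hE, hO] at this
    rw [← this]
    rfl
  refine (Finset.sum_congr rfl (fun i _ => key i)).trans ?_
  refine (aux_sum_two (fun a : ℕ => auxRow F G a x *
        ∑ q ∈ Finset.range N, (ψ a (2 * q) * F q y + ψ a (2 * q + 1) * G q y)) N).trans ?_
  apply Finset.sum_congr rfl
  intro p hp
  simp only [hE, hO]
  have e1 : ∀ q, ψ (2 * p) (2 * q) = 0 := by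
    intro q
    simp only [ψ]
    rw [if_neg (by omega), if_neg (by omega)]
  have e2 : ∀ q, ψ (2 * p + 1) (2 * q + 1) = 0 := by
    intro q
    simp only [ψ]
    rw [if_neg (by omega), if_neg (by omega)]
  have e3 : ∀ q, ψ (2 * p) (2 * q + 1) = if p = q then 1 else 0 := by
    intro q
    simp only [ψ]
    by_cases h : p = q
    · rw [if_pos (by omega), if_pos h]
    · rw [if_neg (by omega), if_neg (by omega), if_neg h]
  have e4 : ∀ q, ψ (2 * p + 1) (2 * q) = if p = q then -1 else 0 := by
    intro q
    simp only [ψ]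
    by_cases h : p = q
    · rw [if_neg (by omega), if_pos (by omega), if_pos h]
    · rw [if_neg (by omega), if_neg (by omega), if_neg h]
  simp only [e1, e2, e3, e4, ite_mul, zero_mul, one_mul, zero_add, add_zero,
    Finset.sum_ite_eq, if_pos hp]
  ring

open Matrix in
lemma aux_decomp {d : ℕ} (m : ℕ) : ∀ (J : Matrix (Fin d) (Fin d) ℝ), Jᵀ = -J →
    d ≤ Module.finrank ℝ (LinearMap.ker (Matrix.toLin' J)) + 2 * m →
    ∃ F G : ℕ → Fin d → ℝ, ∀ x y, J x y =
      ∑ p ∈ Finset.range m, (F p x * G p y - G p x * F p y) := by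
  induction m with
  | zero =>
    intro J hJ h
    have : LinearMap.ker (Matrix.toLin' J) = ⊤ := by
      apply Submodule.eq_top_of_finrank_eq
      apply le_antisymm (Submodule.finrank_le _)
      simpa using h
    rw [LinearMap.ker_eq_top] at this
    have h0 : J = 0 := by simpa using this
    exact ⟨0, 0, by simp [h0]⟩
  | succ m ih =>
    intro J hJ h
    by_cases h0 : J = 0
    · exact ⟨0, 0, by simp [h0]⟩
    obtain ⟨a, b, hab⟩ : ∃ a b, J a b ≠ 0 := by
      by_contra! hc
      exact h0 (by ext a b; simpa using hc a b)
    have skew : ∀ x y : Fin d → ℝ, x ⬝ᵥ (J *ᵥ y) = - (y ⬝ᵥ (J *ᵥ x)) := by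
      intro x y
      rw [dotProduct_mulVec, ← mulVec_transpose, hJ, neg_mulVec, neg_dotProduct, dotProduct_comm]
    obtain ⟨u, v, huv⟩ : ∃ u v : Fin d → ℝ, u ⬝ᵥ (J *ᵥ v) = 1 := by
      refine ⟨Pi.single a 1, Pi.single b (J a b)⁻¹, ?_⟩
      simp [hab]
    have huu : u ⬝ᵥ (J *ᵥ u) = 0 := by linarith [skew u u]
    have hvv : v ⬝ᵥ (J *ᵥ v) = 0 := by linarith [skew v v]
    have hvu : v ⬝ᵥ (J *ᵥ u) = -1 := by linarith [skew v u]
    -- B(x,v) = x ⬝ J v ; B(u,y) = - y ⬝ J u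
    set f := J *ᵥ v with hf
    set g := -(J *ᵥ u) with hg
    let J' : Matrix (Fin d) (Fin d) ℝ := J - (vecMulVec f g - vecMulVec g f)
    have hJ'v : ∀ x, J' *ᵥ x = J *ᵥ x - ((g ⬝ᵥ x) • f - (f ⬝ᵥ x) • g) := by
      intro x
      simp only [J', sub_mulVec, vecMulVec_mulVec]
      simp
    have hJ'k : ∀ x, J *ᵥ x = 0 → J' *ᵥ x = 0 := by
      intro x hx
      have h1 : g ⬝ᵥ x = 0 := by
        rw [dotProduct_comm, hg, dotProduct_neg, skew, hx]; simp
      have h2 : f ⬝ᵥ x = 0 := by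
        rw [dotProduct_comm, hf, skew, hx]; simp
      rw [hJ'v, hx, h1, h2]; simp
    have hJ'u : J' *ᵥ u = 0 := by
      have h1 : g ⬝ᵥ u = 0 := by
        rw [dotProduct_comm, hg, dotProduct_neg, huu, neg_zero]
      have h2 : f ⬝ᵥ u = 1 := by rw [dotProduct_comm, huv]
      rw [hJ'v, h1, h2]; simp [hg]
    have hJ'w : J' *ᵥ v = 0 := by
      have h1 : g ⬝ᵥ v = 1 := by
        rw [dotProduct_comm, hg, dotProduct_neg, hvu, neg_neg]
      have h2 : f ⬝ᵥ v = 0 := by rw [dotProduct_comm, hvv]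
      rw [hJ'v, h1, h2]; simp [hf]
    have hskew' : J'ᵀ = -J' := by
      simp only [J', transpose_sub, transpose_vecMulVec, hJ]
      abel
    let L : (LinearMap.ker (Matrix.toLin' J) × ℝ × ℝ) →ₗ[ℝ] LinearMap.ker (Matrix.toLin' J') :=
      { toFun := fun t => ⟨t.1.1 + t.2.1 • u + t.2.2 • v, by
          have ht : J *ᵥ t.1.1 = 0 := by
            have h := t.1.2
            rwa [LinearMap.mem_ker, Matrix.toLin'_apply] at h
          simp [mulVec_add, mulVec_smul, hJ'u, hJ'w, hJ'k _ ht]⟩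
        map_add' := by
          intro s t
          ext i
          simp
          ring
        map_smul' := by
          intro c t
          ext i
          simp
          ring }
    have hL : Function.Injective L := by
      rw [← LinearMap.ker_eq_bot, LinearMap.ker_eq_bot']
      rintro ⟨⟨x, hx⟩, α, β⟩ ht
      have hx' : J *ᵥ x = 0 := by simpa using hx
      have h1 : x + α • u + β • v = 0 := congrArg Subtype.val ht
      have h2 : α • (J *ᵥ u) + β • (J *ᵥ v) = 0 := by
        have := congrArg (fun z => J *ᵥ z) h1
        simpa [mulVec_add, mulVec_smul, hx'] using this
      have h3 : β = 0 := by
        have := congrArg (fun z => u ⬝ᵥ z) h2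
        simpa [dotProduct_add, dotProduct_smul, huu, huv, ← hf] using this
      have h4 : α = 0 := by
        have := congrArg (fun z => v ⬝ᵥ z) h2
        simpa [dotProduct_add, dotProduct_smul, hvu, hvv, ← hf] using this
      subst h3 h4
      have h5 : x = 0 := by simpa using h1
      subst h5
      rfl
    have hfin := LinearMap.finrank_le_finrank_of_injective hL
    simp only [Module.finrank_prod, Module.finrank_self] at hfin
    obtain ⟨F, G, hFG⟩ := ih J' hskew' (by omega)
    refine ⟨fun p => if p = m then f else F p, fun p => if p = m then g else G p, ?_⟩
    intro x y
    rw [Finset.sum_range_succ]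
    have : ∑ p ∈ Finset.range m, ((if p = m then f else F p) x * (if p = m then g else G p) y -
        (if p = m then g else G p) x * (if p = m then f else F p) y) = J' x y := by
      rw [hFG]
      apply Finset.sum_congr rfl
      intro p hp
      have : p ≠ m := by
        have := Finset.mem_range.1 hp
        omega
      simp [this]
    rw [this]
    simp [J', vecMulVec_apply]

theorem stmt_13 (n k : ℕ) (hn : 1 ≤ n)
    (J : Matrix (Fin (2 * n)) (Fin (2 * n)) ℝ) (hJ : Jᵀ = -J)
    (hker : Module.finrank ℝ (LinearMap.ker (Matrix.toLin' J)) = 2 * k) :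
    ∃ Y : Matrix (Fin (2 * (n + k))) (Fin (2 * n)) ℝ,
      Y.rank = 2 * n ∧ Yᵀ * stdSymplectic (n + k) * Y = J := by
  have hkn : k ≤ n := by
    have := Submodule.finrank_le (LinearMap.ker (Matrix.toLin' J))
    simp only [Module.finrank_fin_fun] at this
    omega
  obtain ⟨m, rfl⟩ : ∃ m, n = m + k := ⟨n - k, by omega⟩
  obtain ⟨F, G, hFG⟩ := aux_decomp m J hJ (by omega)
  let e : LinearMap.ker (Matrix.toLin' J) ≃ₗ[ℝ] (Fin (2 * k) → ℝ) :=
    LinearEquiv.ofFinrankEq _ _ (by rw [hker]; simp)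
  obtain ⟨H, hH⟩ := LinearMap.exists_extend e.toLinearMap
  let A := LinearMap.toMatrix' H
  let F' : ℕ → Fin (2 * (m + k)) → ℝ := fun p =>
    if p < m then F p else if h : p - m < 2 * k then A ⟨p - m, h⟩ else 0
  let G' : ℕ → Fin (2 * (m + k)) → ℝ := fun p => if p < m then G p else 0
  let Y : Matrix (Fin (2 * (m + k + k))) (Fin (2 * (m + k))) ℝ :=
    Matrix.of fun i j => auxRow F' G' i.val j
  have hY : Yᵀ * stdSymplectic (m + k + k) * Y = J := by
    ext x y
    rw [aux_form, hFG]
    have hs : Finset.range m ⊆ Finset.range (m + k + k) := by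
      intro p; simp only [Finset.mem_range]; omega
    rw [← Finset.sum_subset hs]
    · apply Finset.sum_congr rfl
      intro p hp
      simp [F', G', Finset.mem_range.1 hp]
    · intro p _ hp
      have : ¬ p < m := by simpa using hp
      simp [G', this]
  refine ⟨Y, ?_, hY⟩
  have hinj : LinearMap.ker Y.mulVecLin = ⊥ := by
    rw [LinearMap.ker_eq_bot']
    intro x hx
    have hx' : Y.mulVec x = 0 := by simpa using hx
    have hJx : x ∈ LinearMap.ker (Matrix.toLin' J) := by
      rw [LinearMap.mem_ker, Matrix.toLin'_apply, ← hY, ← Matrix.mulVec_mulVec, hx',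
        Matrix.mulVec_zero]
    have hHx : H x = 0 := by
      have : H x = A.mulVec x := by
        simp [A, LinearMap.toMatrix'_mulVec]
      rw [this]
      ext j
      have hj := j.2
      have h1 := congrFun hx' ⟨2 * (m + j.val), by omega⟩
      have h2 : Y ⟨2 * (m + j.val), by omega⟩ = A j := by
        funext z
        simp [Y, auxRow, F']
      simp only [Matrix.mulVec, h2] at h1
      exact h1
    have h3 : e ⟨x, hJx⟩ = 0 := by
      have := LinearMap.congr_fun hH ⟨x, hJx⟩
      simp only [LinearMap.comp_apply, Submodule.subtype_apply, hHx] at this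
      exact this.symm
    have h4 := (LinearEquiv.map_eq_zero_iff e).1 h3
    exact congrArg Subtype.val h4
  have := LinearMap.finrank_range_of_inj (LinearMap.ker_eq_bot.1 hinj)
  rw [Matrix.rank, this]
  simp
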